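/- For all integers k,s ≥ 1 and c ∈ {0,1}, the set 𝓚 = 𝓑₁₂ ∪ 𝓑₂₁ ∪ 𝓚₁₁ ∪ 𝓚₂₂ is an F-basis of the commutator subspace K(A^{k,s}_c); in particular dim_F K(A^{k,s}_c) = 8k − 2 = dim_F A^{k,s}_c − dim_F Z(A^{k,s}_c). -/

import Mathlib

/- Common setup: the algebras D(2B)^{k,s}(c) of dihedral type, over a field F,
   presented as a quotient of the free algebra on the paths-generators
   e₁, e₂ (trivial paths), α (loop at vertex 1), β (arrow 1 → 2),
   γ (arrow 2 → 1), η (loop at vertex 2), by the path-algebra relations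
   together with Erdmann's relations
   βη = 0, ηγ = 0, γβ = 0, α² = c(αβγ)^k, (αβγ)^k = (βγα)^k, η^s = (γαβ)^k. -/

noncomputable section

namespace DihedralPaper

inductive Gen : Type
  | e1 | e2 | a | b | g | h

variable (F : Type) [Field F]

/-- The generators inside the free algebra. -/
def gen (t : Gen) : FreeAlgebra F Gen := FreeAlgebra.ι F t

/-- The defining relations of `D(2B)^{k,s}(c)` (paths written from left to right). -/
inductive Rel (k s : ℕ) (c : F) : FreeAlgebra F Gen → FreeAlgebra F Gen → Prop
  | unit : Rel k s c (gen F .e1 + gen F .e2) 1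
  | idem1 : Rel k s c (gen F .e1 * gen F .e1) (gen F .e1)
  | idem2 : Rel k s c (gen F .e2 * gen F .e2) (gen F .e2)
  | orth12 : Rel k s c (gen F .e1 * gen F .e2) 0
  | orth21 : Rel k s c (gen F .e2 * gen F .e1) 0
  | aL : Rel k s c (gen F .e1 * gen F .a) (gen F .a)
  | aR : Rel k s c (gen F .a * gen F .e1) (gen F .a)
  | bL : Rel k s c (gen F .e1 * gen F .b) (gen F .b)
  | bR : Rel k s c (gen F .b * gen F .e2) (gen F .b)
  | gL : Rel k s c (gen F .e2 * gen F .g) (gen F .g)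
  | gR : Rel k s c (gen F .g * gen F .e1) (gen F .g)
  | hL : Rel k s c (gen F .e2 * gen F .h) (gen F .h)
  | hR : Rel k s c (gen F .h * gen F .e2) (gen F .h)
  | bh : Rel k s c (gen F .b * gen F .h) 0
  | hg : Rel k s c (gen F .h * gen F .g) 0
  | gb : Rel k s c (gen F .g * gen F .b) 0
  | asq : Rel k s c (gen F .a * gen F .a) (c • (gen F .a * gen F .b * gen F .g) ^ k)
  | abg : Rel k s c ((gen F .a * gen F .b * gen F .g) ^ k) ((gen F .b * gen F .g * gen F .a) ^ k)
  | hs : Rel k s c ((gen F .h) ^ s) ((gen F .g * gen F .a * gen F .b) ^ k)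

/-- The algebra `A^{k,s}_c = D(2B)^{k,s}(c)`. -/
def DA (k s : ℕ) (c : F) : Type := RingQuot (Rel F k s c)

instance (k s : ℕ) (c : F) : Ring (DA F k s c) :=
  inferInstanceAs (Ring (RingQuot (Rel F k s c)))

instance (k s : ℕ) (c : F) : Algebra F (DA F k s c) :=
  inferInstanceAs (Algebra F (RingQuot (Rel F k s c)))

variable (k s : ℕ) (c : F)

/-- The canonical projection. -/
def mk : FreeAlgebra F Gen →ₐ[F] DA F k s c := RingQuot.mkAlgHom F (Rel F k s c)

def E1 : DA F k s c := mk F k s c (gen F .e1)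
def E2 : DA F k s c := mk F k s c (gen F .e2)
/-- The image of the loop α at vertex 1. -/
def Al : DA F k s c := mk F k s c (gen F .a)
/-- The image of the arrow β : 1 → 2. -/
def Be : DA F k s c := mk F k s c (gen F .b)
/-- The image of the arrow γ : 2 → 1. -/
def Ga : DA F k s c := mk F k s c (gen F .g)
/-- The image of the loop η at vertex 2. -/
def Et : DA F k s c := mk F k s c (gen F .h)

/-- The path αβγ. -/
def ABG : DA F k s c := Al F k s c * Be F k s c * Ga F k s c
/-- The path βγα. -/
def BGA : DA F k s c := Be F k s c * Ga F k s c * Al F k s c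
/-- The path γαβ. -/
def GAB : DA F k s c := Ga F k s c * Al F k s c * Be F k s c

/-- The standard basis paths 𝓑₁₁ of e₁Ae₁. -/
def B11 : Set (DA F k s c) :=
  {E1 F k s c, Al F k s c, Be F k s c * Ga F k s c, (ABG F k s c) ^ k}
    ∪ (fun i => (ABG F k s c) ^ i) '' Set.Icc 1 (k - 1)
    ∪ (fun i => (ABG F k s c) ^ i * Al F k s c) '' Set.Icc 1 (k - 1)
    ∪ (fun i => (BGA F k s c) ^ i) '' Set.Icc 1 (k - 1)
    ∪ (fun i => (BGA F k s c) ^ i * (Be F k s c * Ga F k s c)) '' Set.Icc 1 (k - 1)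

/-- The standard basis paths 𝓑₁₂ of e₁Ae₂. -/
def B12 : Set (DA F k s c) :=
  {Be F k s c, Al F k s c * Be F k s c}
    ∪ (fun i => (BGA F k s c) ^ i * Be F k s c) '' Set.Icc 1 (k - 1)
    ∪ (fun i => (ABG F k s c) ^ i * (Al F k s c * Be F k s c)) '' Set.Icc 1 (k - 1)

/-- The standard basis paths 𝓑₂₁ of e₂Ae₁. -/
def B21 : Set (DA F k s c) :=
  {Ga F k s c, Ga F k s c * Al F k s c}
    ∪ (fun i => (GAB F k s c) ^ i * Ga F k s c) '' Set.Icc 1 (k - 1)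
    ∪ (fun i => (GAB F k s c) ^ i * (Ga F k s c * Al F k s c)) '' Set.Icc 1 (k - 1)

/-- The standard basis paths 𝓑₂₂ of e₂Ae₂. -/
def B22 : Set (DA F k s c) :=
  {E2 F k s c}
    ∪ (fun i => (GAB F k s c) ^ i) '' Set.Icc 1 (k - 1)
    ∪ (fun j => (Et F k s c) ^ j) '' Set.Icc 1 s

/-- The standard path basis 𝓑 of `A^{k,s}_c`. -/
def BB : Set (DA F k s c) :=
  B11 F k s c ∪ B12 F k s c ∪ B21 F k s c ∪ B22 F k s c

/-- The commutator subspace K(A): the F-linear span of all commutators. -/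
def Kspan (A : Type) [Ring A] [Algebra F A] : Submodule F A :=
  Submodule.span F {z : A | ∃ u v : A, z = u * v - v * u}

/-- The (left) socle of a ring: the sum of all simple (left) submodules. -/
def socle (A : Type) [Ring A] : Submodule A A := sSup {S : Submodule A A | IsAtom S}

/-- `ψ` is the linear form sending each standard basis path lying in the socle to 1
    and every other standard basis path to 0. -/
def SoclePsi (ψ : DA F k s c →ₗ[F] F) : Prop :=
  ∀ p ∈ BB F k s c,
    (p ∈ socle (DA F k s c) → ψ p = 1) ∧ (p ∉ socle (DA F k s c) → ψ p = 0)

/-- `T₁(A) = {x : x² ∈ K(A)}`. -/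
def T1set : Set (DA F k s c) := {z | z ^ 2 ∈ Kspan F (DA F k s c)}

/-- The orthogonal space `T₁(A)^⊥` with respect to the form `⟨x, y⟩ = ψ(xy)`. -/
def T1perp (ψ : DA F k s c →ₗ[F] F) : Set (DA F k s c) :=
  {y | ∀ x ∈ T1set F k s c, ψ (y * x) = 0}

/-- The first generalized Reynolds ideal, as an ideal of the center `Z(A)`. -/
def ReynoldsIdeal (ψ : DA F k s c →ₗ[F] F) :
    Ideal (Subalgebra.center F (DA F k s c)) :=
  Ideal.span {z : Subalgebra.center F (DA F k s c) | (z : DA F k s c) ∈ T1perp F k s c ψ}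


/-- The set 𝓚₁₁. -/
def K11 : Set (DA F k s c) :=
  {Be F k s c * Ga F k s c}
    ∪ (fun i => (ABG F k s c) ^ i + (BGA F k s c) ^ i) '' Set.Icc 1 (k - 1)
    ∪ (fun i => (ABG F k s c) ^ i * Al F k s c) '' Set.Icc 1 (k - 1)
    ∪ (fun i => (BGA F k s c) ^ i * (Be F k s c * Ga F k s c)) '' Set.Icc 1 (k - 1)

/-- The set 𝓚₂₂. -/
def K22 : Set (DA F k s c) :=
  (fun i => (ABG F k s c) ^ i + (GAB F k s c) ^ i) '' Set.Icc 1 k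

/-- The set 𝓚 = 𝓑₁₂ ∪ 𝓑₂₁ ∪ 𝓚₁₁ ∪ 𝓚₂₂, a basis of the commutator subspace. -/
def KK : Set (DA F k s c) :=
  B12 F k s c ∪ B21 F k s c ∪ K11 F k s c ∪ K22 F k s c

/-! ### The generic model

The trace form of `DA F k s c` is computed in the product of the `3 × 3` matrices over `F[X]`
(the cycle `αβγ`, with vertex `1` split in two), `F[X]` (the loop `η`) and `F[X]`
(which only records powers of `α`). -/

section Model

open Polynomial Matrix

abbrev Model : Type := Matrix (Fin 3) (Fin 3) F[X] × F[X] × F[X]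

/-- The images of the generators in the model. -/
def modelGen : Gen → Model F
  | .e1 => (single 0 0 1 + single 1 1 1, 0, 1)
  | .e2 => (single 2 2 1, 1, 0)
  | .a => (single 0 1 1, 0, X)
  | .b => (single 1 2 1, 0, 0)
  | .g => (single 2 0 X, 0, 0)
  | .h => (0, X, 0)

def toModel : FreeAlgebra F Gen →ₐ[F] Model F := FreeAlgebra.lift F (modelGen F)

@[simp] lemma toModel_gen (t : Gen) : toModel F (gen F t) = modelGen F t :=
  FreeAlgebra.lift_ι_apply ..

/-- A subalgebra of the model containing the image of the free algebra. -/
def modelOrder : Subalgebra F (Model F) where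
  carrier := {r | (r.1 1 0).coeff 0 = 0 ∧ (r.1 2 0).coeff 0 = 0 ∧ (r.1 2 1).coeff 0 = 0 ∧
    (r.1 1 1).coeff 0 = (r.1 0 0).coeff 0 ∧ r.2.2.coeff 0 = (r.1 0 0).coeff 0 ∧
    r.2.2.coeff 1 = (r.1 0 1).coeff 0 ∧ r.2.1.coeff 0 = (r.1 2 2).coeff 0}
  mul_mem' := by
    rintro ⟨M, p, q⟩ ⟨M', p', q'⟩ ⟨h1, h2, h3, h4, h5, h6, h7⟩ ⟨h1', h2', h3', h4', h5', h6', h7'⟩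
    simp only at h1 h2 h3 h4 h5 h6 h7 h1' h2' h3' h4' h5' h6' h7'
    simp only [Set.mem_ofPred_eq, Prod.mk_mul_mk, mul_apply, Fin.sum_univ_three, coeff_add,
      mul_coeff_zero, mul_coeff_one, h1, h2, h3, h4, h5, h6, h7, h1', h2', h3', h4', h5', h6', h7']
    refine ⟨?_, ?_, ?_, ?_, ?_, ?_, ?_⟩ <;> ring
  add_mem' := by
    rintro ⟨M, p, q⟩ ⟨M', p', q'⟩ ⟨h1, h2, h3, h4, h5, h6, h7⟩ ⟨h1', h2', h3', h4', h5', h6', h7'⟩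
    simp only at h1 h2 h3 h4 h5 h6 h7 h1' h2' h3' h4' h5' h6' h7'
    simp [h1, h2, h3, h4, h5, h6, h7, h1', h2', h3', h4', h5', h6', h7']
  algebraMap_mem' r := by
    simp [Matrix.algebraMap_matrix_apply]

variable {F} in
lemma mem_modelOrder {r : Model F} : r ∈ modelOrder F ↔
    (r.1 1 0).coeff 0 = 0 ∧ (r.1 2 0).coeff 0 = 0 ∧ (r.1 2 1).coeff 0 = 0 ∧
    (r.1 1 1).coeff 0 = (r.1 0 0).coeff 0 ∧ r.2.2.coeff 0 = (r.1 0 0).coeff 0 ∧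
    r.2.2.coeff 1 = (r.1 0 1).coeff 0 ∧ r.2.1.coeff 0 = (r.1 2 2).coeff 0 := Iff.rfl

lemma toModel_mem (w : FreeAlgebra F Gen) : toModel F w ∈ modelOrder F := by
  induction w using FreeAlgebra.induction with
  | grade0 r => rw [AlgHom.commutes]; exact Subalgebra.algebraMap_mem _ _
  | grade1 x =>
    have : toModel F (FreeAlgebra.ι F x) = modelGen F x := toModel_gen F x
    rw [this]
    cases x <;> simp [mem_modelOrder, modelGen, coeff_one]
  | mul a b ha hb => rw [map_mul]; exact mul_mem ha hb
  | add a b ha hb => rw [map_add]; exact add_mem ha hb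

/-- The symmetrizing form on the model. -/
def modelTrace : Model F →ₗ[F] F :=
  lcoeff F k ∘ₗ (Matrix.traceLinearMap (Fin 3) F F[X]) ∘ₗ LinearMap.fst F _ _ +
    lcoeff F s ∘ₗ LinearMap.fst F _ _ ∘ₗ LinearMap.snd F _ _ +
    c • lcoeff F 2 ∘ₗ LinearMap.snd F _ _ ∘ₗ LinearMap.snd F _ _

lemma modelTrace_apply (r : Model F) :
    modelTrace F k s c r = r.1.trace.coeff k + r.2.1.coeff s + c * r.2.2.coeff 2 := rfl

lemma modelTrace_mul_comm (r r' : Model F) :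
    modelTrace F k s c (r * r') = modelTrace F k s c (r' * r) := by
  simp [modelTrace_apply, Matrix.trace_mul_comm r.1, mul_comm r.2.1, mul_comm r.2.2]

variable {F k s} in
lemma modelGen_pow_ABG {n : ℕ} (hn : 1 ≤ n) :
    (modelGen F .a * modelGen F .b * modelGen F .g) ^ n = (single 0 0 (X ^ n), 0, 0) := by
  induction n, hn using Nat.le_induction with
  | base => simp [modelGen]
  | succ n hn ih => rw [pow_succ, ih]; simp [modelGen, pow_succ]

variable {F k s} in
lemma modelGen_pow_BGA {n : ℕ} (hn : 1 ≤ n) :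
    (modelGen F .b * modelGen F .g * modelGen F .a) ^ n = (single 1 1 (X ^ n), 0, 0) := by
  induction n, hn using Nat.le_induction with
  | base => simp [modelGen]
  | succ n hn ih => rw [pow_succ, ih]; simp [modelGen, pow_succ]

variable {F k s} in
lemma modelGen_pow_GAB {n : ℕ} (hn : 1 ≤ n) :
    (modelGen F .g * modelGen F .a * modelGen F .b) ^ n = (single 2 2 (X ^ n), 0, 0) := by
  induction n, hn using Nat.le_induction with
  | base => simp [modelGen]
  | succ n hn ih => rw [pow_succ, ih]; simp [modelGen, pow_succ]

variable {F k s} in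
lemma modelGen_pow_h {n : ℕ} (hn : 1 ≤ n) : modelGen F .h ^ n = (0, X ^ n, 0) := by
  induction n, hn using Nat.le_induction with
  | base => simp [modelGen]
  | succ n hn ih => rw [pow_succ, ih]; simp [modelGen, pow_succ]

variable {F k s} in
lemma modelTrace_rel (hk : 1 ≤ k) (hs : 1 ≤ s) {x y : FreeAlgebra F Gen} (h : Rel F k s c x y)
    {r : Model F} (hr : r ∈ modelOrder F) :
    modelTrace F k s c (toModel F x * r) = modelTrace F k s c (toModel F y * r) := by
  obtain ⟨M, p, q⟩ := r
  obtain ⟨h1, h2, h3, h4, h5, h6, h7⟩ := hr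
  simp only at h1 h2 h3 h4 h5 h6 h7
  cases h
  case unit =>
    have : toModel F (gen F .e1 + gen F .e2) = toModel F 1 := by
      simp only [map_add, toModel_gen, modelGen, map_one]
      ext i j
      · fin_cases i <;> fin_cases j <;> simp
      all_goals simp
    rw [this]
  case asq =>
    rw [map_smul, map_pow, map_mul (toModel F), map_mul (toModel F), map_mul (toModel F)]
    simp only [toModel_gen]
    rw [modelGen_pow_ABG hk]
    simp [modelGen, modelTrace_apply, trace_single_mul, coeff_X_pow_mul', ← pow_two X, h5]
  case abg =>
    simp only [map_pow, map_mul (toModel F), toModel_gen]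
    rw [modelGen_pow_ABG hk, modelGen_pow_BGA hk]
    simp [modelTrace_apply, trace_single_mul, coeff_X_pow_mul', h4]
  case hs =>
    simp only [map_pow, map_mul (toModel F), toModel_gen]
    rw [modelGen_pow_GAB hk, modelGen_pow_h hs]
    simp [modelTrace_apply, trace_single_mul, coeff_X_pow_mul', h7]
  all_goals
    refine congrArg (fun t => modelTrace F k s c (t * (M, p, q))) ?_
    rw [map_mul (toModel F)]
    simp [modelGen, add_mul, mul_add]

variable {F k s c} in
/-- Words with the same pairing against all words. -/
def traceCon : RingCon (FreeAlgebra F Gen) where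
  r w w' := ∀ v, modelTrace F k s c (toModel F (w * v)) = modelTrace F k s c (toModel F (w' * v))
  iseqv := ⟨fun _ _ => rfl, fun h v => (h v).symm, fun h h' v => (h v).trans (h' v)⟩
  mul' {w x y z} h h' v := by
    rw [mul_assoc w, h, map_mul (toModel F), modelTrace_mul_comm, ← map_mul (toModel F),
      mul_assoc y, h', ← mul_assoc, map_mul (toModel F), modelTrace_mul_comm,
      ← map_mul (toModel F), ← mul_assoc]
  add' h h' v := by simp only [add_mul, map_add, h v, h' v]

variable {F k s c} in
lemma modelTrace_eq_of_mk_eq (hk : 1 ≤ k) (hs : 1 ≤ s) {w w' : FreeAlgebra F Gen}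
    (h : mk F k s c w = mk F k s c w') :
    modelTrace F k s c (toModel F w) = modelTrace F k s c (toModel F w') := by
  have key : ∀ ⦃x y⦄, Rel F k s c x y →
      (traceCon (k := k) (s := s) (c := c)).mkₐ (α := F) x = RingCon.mkₐ (α := F) _ y := by
    intro x y hxy
    refine (RingCon.eq _).2 fun v => ?_
    rw [map_mul (toModel F), map_mul (toModel F)]
    exact modelTrace_rel c hk hs hxy (toModel_mem F v)
  have h2 : RingCon.mkₐ (α := F) (traceCon (k := k) (s := s) (c := c)) w =
      RingCon.mkₐ (α := F) _ w' :=
    (RingQuot.liftAlgHom_mkAlgHom_apply F _ key w).symm.trans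
      ((congrArg (RingQuot.liftAlgHom F ⟨_, key⟩) h).trans
        (RingQuot.liftAlgHom_mkAlgHom_apply F _ key w'))
  simpa using (RingCon.eq _).1 h2 1

lemma mk_surjective : Function.Surjective (mk F k s c) := RingQuot.mkAlgHom_surjective F _

lemma exists_trace (hk : 1 ≤ k) (hs : 1 ≤ s) :
    ∃ ψ : DA F k s c →ₗ[F] F, ∀ w, ψ (mk F k s c w) = modelTrace F k s c (toModel F w) := by
  obtain ⟨g, hg⟩ := (mk F k s c).toLinearMap.exists_rightInverse_of_surjective
    (LinearMap.range_eq_top.2 (mk_surjective F k s c))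
  refine ⟨modelTrace F k s c ∘ₗ (toModel F).toLinearMap ∘ₗ g, fun w => ?_⟩
  exact modelTrace_eq_of_mk_eq hk hs (LinearMap.congr_fun hg _)

end Model

/-! ### Relations in `DA F k s c` -/

section Relations

variable {F k s c}

lemma mk_eq_of_rel {x y : FreeAlgebra F Gen} (h : Rel F k s c x y) :
    mk F k s c x = mk F k s c y := RingQuot.mkAlgHom_rel F h

@[simp] lemma E1_mul_E1 : E1 F k s c * E1 F k s c = E1 F k s c := by
  simpa only [map_mul] using! mk_eq_of_rel Rel.idem1

@[simp] lemma E2_mul_E2 : E2 F k s c * E2 F k s c = E2 F k s c := by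
  simpa only [map_mul] using! mk_eq_of_rel Rel.idem2

@[simp] lemma E1_mul_E2 : E1 F k s c * E2 F k s c = 0 := by
  simpa only [map_mul, map_zero] using! mk_eq_of_rel (F := F) (k := k) (s := s) (c := c) Rel.orth12

@[simp] lemma E2_mul_E1 : E2 F k s c * E1 F k s c = 0 := by
  simpa only [map_mul, map_zero] using! mk_eq_of_rel (F := F) (k := k) (s := s) (c := c) Rel.orth21

@[simp] lemma E1_mul_Al : E1 F k s c * Al F k s c = Al F k s c := by
  simpa only [map_mul] using! mk_eq_of_rel Rel.aL

@[simp] lemma Al_mul_E1 : Al F k s c * E1 F k s c = Al F k s c := by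
  simpa only [map_mul] using! mk_eq_of_rel Rel.aR

@[simp] lemma E1_mul_Be : E1 F k s c * Be F k s c = Be F k s c := by
  simpa only [map_mul] using! mk_eq_of_rel Rel.bL

@[simp] lemma Be_mul_E2 : Be F k s c * E2 F k s c = Be F k s c := by
  simpa only [map_mul] using! mk_eq_of_rel Rel.bR

@[simp] lemma E2_mul_Ga : E2 F k s c * Ga F k s c = Ga F k s c := by
  simpa only [map_mul] using! mk_eq_of_rel Rel.gL

@[simp] lemma Ga_mul_E1 : Ga F k s c * E1 F k s c = Ga F k s c := by
  simpa only [map_mul] using! mk_eq_of_rel Rel.gR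

@[simp] lemma E2_mul_Et : E2 F k s c * Et F k s c = Et F k s c := by
  simpa only [map_mul] using! mk_eq_of_rel Rel.hL

@[simp] lemma Et_mul_E2 : Et F k s c * E2 F k s c = Et F k s c := by
  simpa only [map_mul] using! mk_eq_of_rel Rel.hR

@[simp] lemma Be_mul_Et : Be F k s c * Et F k s c = 0 := by
  simpa only [map_mul, map_zero] using! mk_eq_of_rel (F := F) (k := k) (s := s) (c := c) Rel.bh

@[simp] lemma Et_mul_Ga : Et F k s c * Ga F k s c = 0 := by
  simpa only [map_mul, map_zero] using! mk_eq_of_rel (F := F) (k := k) (s := s) (c := c) Rel.hg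

@[simp] lemma Ga_mul_Be : Ga F k s c * Be F k s c = 0 := by
  simpa only [map_mul, map_zero] using! mk_eq_of_rel (F := F) (k := k) (s := s) (c := c) Rel.gb

@[simp] lemma E2_mul_Al : E2 F k s c * Al F k s c = 0 := by
  rw [← E1_mul_Al, ← mul_assoc, E2_mul_E1, zero_mul]

@[simp] lemma Al_mul_E2 : Al F k s c * E2 F k s c = 0 := by
  rw [← Al_mul_E1, mul_assoc, E1_mul_E2, mul_zero]

@[simp] lemma E2_mul_Be : E2 F k s c * Be F k s c = 0 := by
  rw [← E1_mul_Be, ← mul_assoc, E2_mul_E1, zero_mul]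

@[simp] lemma Be_mul_E1 : Be F k s c * E1 F k s c = 0 := by
  rw [← Be_mul_E2, mul_assoc, E2_mul_E1, mul_zero]

@[simp] lemma E1_mul_Ga : E1 F k s c * Ga F k s c = 0 := by
  rw [← E2_mul_Ga, ← mul_assoc, E1_mul_E2, zero_mul]

@[simp] lemma Ga_mul_E2 : Ga F k s c * E2 F k s c = 0 := by
  rw [← Ga_mul_E1, mul_assoc, E1_mul_E2, mul_zero]

@[simp] lemma E1_mul_Et : E1 F k s c * Et F k s c = 0 := by
  rw [← E2_mul_Et, ← mul_assoc, E1_mul_E2, zero_mul]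

@[simp] lemma Et_mul_E1 : Et F k s c * E1 F k s c = 0 := by
  rw [← Et_mul_E2, mul_assoc, E2_mul_E1, mul_zero]

@[simp] lemma Al_mul_Ga : Al F k s c * Ga F k s c = 0 := by
  rw [← E2_mul_Ga, ← mul_assoc, Al_mul_E2, zero_mul]

@[simp] lemma Al_mul_Et : Al F k s c * Et F k s c = 0 := by
  rw [← E2_mul_Et, ← mul_assoc, Al_mul_E2, zero_mul]

@[simp] lemma Be_mul_Al : Be F k s c * Al F k s c = 0 := by
  rw [← E1_mul_Al, ← mul_assoc, Be_mul_E1, zero_mul]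

@[simp] lemma Be_mul_Be : Be F k s c * Be F k s c = 0 := by
  nth_rw 2 [← E1_mul_Be]
  rw [← mul_assoc, Be_mul_E1, zero_mul]

@[simp] lemma Ga_mul_Ga : Ga F k s c * Ga F k s c = 0 := by
  nth_rw 2 [← E2_mul_Ga]
  rw [← mul_assoc, Ga_mul_E2, zero_mul]

@[simp] lemma Ga_mul_Et : Ga F k s c * Et F k s c = 0 := by
  rw [← E2_mul_Et, ← mul_assoc, Ga_mul_E2, zero_mul]

@[simp] lemma Et_mul_Al : Et F k s c * Al F k s c = 0 := by
  rw [← E1_mul_Al, ← mul_assoc, Et_mul_E1, zero_mul]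

@[simp] lemma Et_mul_Be : Et F k s c * Be F k s c = 0 := by
  rw [← E1_mul_Be, ← mul_assoc, Et_mul_E1, zero_mul]

lemma E1_add_E2 : E1 F k s c + E2 F k s c = 1 := by
  simpa only [map_add, map_one] using! mk_eq_of_rel (F := F) (k := k) (s := s) (c := c) Rel.unit

lemma Al_mul_Al : Al F k s c * Al F k s c = c • ABG F k s c ^ k := by
  simpa only [map_mul, map_smul, map_pow] using!
    mk_eq_of_rel (F := F) (k := k) (s := s) (c := c) Rel.asq

lemma ABG_pow_eq_BGA_pow : ABG F k s c ^ k = BGA F k s c ^ k := by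
  simpa only [map_mul, map_pow] using! mk_eq_of_rel (F := F) (k := k) (s := s) (c := c) Rel.abg

lemma Et_pow_eq_GAB_pow : Et F k s c ^ s = GAB F k s c ^ k := by
  simpa only [map_mul, map_pow] using! mk_eq_of_rel (F := F) (k := k) (s := s) (c := c) Rel.hs

lemma ABG_pow_mul_Al (n : ℕ) :
    ABG F k s c ^ n * Al F k s c = Al F k s c * BGA F k s c ^ n := by
  have h : SemiconjBy (Al F k s c) (BGA F k s c) (ABG F k s c) := by
    simp only [SemiconjBy, ABG, BGA, mul_assoc]
  exact (h.pow_right n).eq.symm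

lemma ABG_pow_mul_AlBe (n : ℕ) :
    ABG F k s c ^ n * (Al F k s c * Be F k s c) =
      Al F k s c * Be F k s c * GAB F k s c ^ n := by
  have h : SemiconjBy (Al F k s c * Be F k s c) (GAB F k s c) (ABG F k s c) := by
    simp only [SemiconjBy, ABG, GAB, mul_assoc]
  exact (h.pow_right n).eq.symm

lemma GAB_pow_mul_Ga (n : ℕ) :
    GAB F k s c ^ n * Ga F k s c = Ga F k s c * ABG F k s c ^ n := by
  have h : SemiconjBy (Ga F k s c) (ABG F k s c) (GAB F k s c) := by
    simp only [SemiconjBy, ABG, GAB, mul_assoc]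
  exact (h.pow_right n).eq.symm

lemma GAB_pow_mul_GaAl (n : ℕ) :
    GAB F k s c ^ n * (Ga F k s c * Al F k s c) =
      Ga F k s c * Al F k s c * BGA F k s c ^ n := by
  rw [← mul_assoc, GAB_pow_mul_Ga, mul_assoc, ABG_pow_mul_Al, mul_assoc]

lemma BGA_pow_mul_Be (n : ℕ) :
    BGA F k s c ^ n * Be F k s c = Be F k s c * GAB F k s c ^ n := by
  have h : SemiconjBy (Be F k s c) (GAB F k s c) (BGA F k s c) := by
    simp only [SemiconjBy, BGA, GAB, mul_assoc]
  exact (h.pow_right n).eq.symm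

lemma Ga_mul_ABG_pow (hk : 1 ≤ k) : Ga F k s c * ABG F k s c ^ k = 0 := by
  rw [ABG_pow_eq_BGA_pow, ← Nat.succ_pred_eq_of_pos hk, pow_succ']
  simp [BGA, ← mul_assoc]

lemma ABG_pow_mul_Be {n : ℕ} (hn : 1 ≤ n) : ABG F k s c ^ n * Be F k s c = 0 := by
  rw [← Nat.succ_pred_eq_of_pos hn, pow_succ]
  simp [ABG, mul_assoc]

lemma ABG_pow_mul_Al_eq_zero (hk : 1 ≤ k) : ABG F k s c ^ k * Al F k s c = 0 := by
  rw [ABG_pow_eq_BGA_pow]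
  have : BGA F k s c * Al F k s c = 0 := by
    simp [BGA, mul_assoc, Al_mul_Al, Ga_mul_ABG_pow hk]
  rw [← pow_sub_one_mul (Nat.one_le_iff_ne_zero.1 hk), mul_assoc, this, mul_zero]

lemma pow_mul_eq_zero_of_le {R : Type} [Ring R] {x y : R} {m n : ℕ} (h : x ^ m * y = 0)
    (hmn : m ≤ n) : x ^ n * y = 0 := by
  rw [← Nat.sub_add_cancel hmn, pow_add, mul_assoc, h, mul_zero]

lemma BGA_pow_mul_Be_eq_zero (hk : 1 ≤ k) : BGA F k s c ^ k * Be F k s c = 0 := by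
  rw [← ABG_pow_eq_BGA_pow, ABG_pow_mul_Be hk]

lemma GAB_pow_mul_Ga_eq_zero (hk : 1 ≤ k) : GAB F k s c ^ k * Ga F k s c = 0 := by
  rw [GAB_pow_mul_Ga, Ga_mul_ABG_pow hk]

lemma ABG_pow_succ_eq_zero (hk : 1 ≤ k) : ABG F k s c ^ (k + 1) = 0 := by
  rw [pow_succ]
  nth_rw 2 [ABG]
  simp only [← mul_assoc, ABG_pow_mul_Al_eq_zero hk, zero_mul]

lemma BGA_pow_succ_eq_zero (hk : 1 ≤ k) : BGA F k s c ^ (k + 1) = 0 := by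
  rw [pow_succ]
  nth_rw 2 [BGA]
  simp only [← mul_assoc, BGA_pow_mul_Be_eq_zero hk, zero_mul]

lemma GAB_pow_succ_eq_zero (hk : 1 ≤ k) : GAB F k s c ^ (k + 1) = 0 := by
  rw [pow_succ]
  nth_rw 2 [GAB]
  simp only [← mul_assoc, GAB_pow_mul_Ga_eq_zero hk, zero_mul]

lemma Et_pow_succ_eq_zero (hk : 1 ≤ k) : Et F k s c ^ (s + 1) = 0 := by
  rw [pow_succ', Et_pow_eq_GAB_pow, ← Nat.succ_pred_eq_of_pos hk, pow_succ']
  simp [GAB, ← mul_assoc]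

lemma Al_mul_ABG_pow (hk : 1 ≤ k) {n : ℕ} (hn : 1 ≤ n) : Al F k s c * ABG F k s c ^ n = 0 := by
  rw [← Nat.succ_pred_eq_of_pos hn, pow_succ']
  nth_rw 1 [ABG]
  simp only [← mul_assoc, Al_mul_Al, smul_mul_assoc, ABG_pow_mul_Be hk, zero_mul, smul_zero]

end Relations

/-! ### Monomials -/

/-- The families of paths: `ai`, `bi`, `gi` run through the initial subwords of `αβγ…`, `βγα…`,
`γαβ…` whose length is congruent to `i` modulo `3`, and `h` through the powers of `η`. -/
inductive Kind : Type
  | a0 | a1 | a2 | b0 | b1 | b2 | g0 | g1 | g2 | h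
  deriving DecidableEq

instance : Fintype Kind :=
  ⟨{.a0, .a1, .a2, .b0, .b1, .b2, .g0, .g1, .g2, .h}, fun x => by cases x <;> simp⟩

section Monomials

def mono : Kind → ℕ → DA F k s c
  | .a0, n => E1 F k s c * ABG F k s c ^ n
  | .a1, n => ABG F k s c ^ n * Al F k s c
  | .a2, n => ABG F k s c ^ n * (Al F k s c * Be F k s c)
  | .b0, n => BGA F k s c ^ (n + 1)
  | .b1, n => BGA F k s c ^ n * Be F k s c
  | .b2, n => BGA F k s c ^ n * (Be F k s c * Ga F k s c)
  | .g0, n => GAB F k s c ^ (n + 1)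
  | .g1, n => GAB F k s c ^ n * Ga F k s c
  | .g2, n => GAB F k s c ^ n * (Ga F k s c * Al F k s c)
  | .h, n => E2 F k s c * Et F k s c ^ n

variable {F k s c}

lemma E1_mul_ABG_pow {n : ℕ} (hn : 1 ≤ n) : E1 F k s c * ABG F k s c ^ n = ABG F k s c ^ n := by
  rw [← Nat.succ_pred_eq_of_pos hn, pow_succ', ← mul_assoc]
  simp [ABG, ← mul_assoc]

lemma E2_mul_Et_pow {n : ℕ} (hn : 1 ≤ n) : E2 F k s c * Et F k s c ^ n = Et F k s c ^ n := by
  rw [← Nat.succ_pred_eq_of_pos hn, pow_succ', ← mul_assoc, E2_mul_Et]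

def monoSpan : Submodule F (DA F k s c) :=
  Submodule.span F (Set.range fun i : Kind × ℕ => mono F k s c i.1 i.2)

lemma mono_mem (κ : Kind) (n : ℕ) : mono F k s c κ n ∈ monoSpan :=
  Submodule.subset_span ⟨(κ, n), rfl⟩

variable (F k s c) in
/-- The image of a generator, unfolded. -/
def arrow : Gen → DA F k s c
  | .e1 => E1 F k s c
  | .e2 => E2 F k s c
  | .a => Al F k s c
  | .b => Be F k s c
  | .g => Ga F k s c
  | .h => Et F k s c

lemma mk_gen (t : Gen) : mk F k s c (gen F t) = arrow F k s c t := by cases t <;> rfl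

lemma mono_mul_arrow_mem (hk : 1 ≤ k) (κ : Kind) (n : ℕ) (t : Gen) :
    mono F k s c κ n * arrow F k s c t ∈ monoSpan (F := F) (k := k) (s := s) (c := c) := by
  have m := mono_mem (F := F) (k := k) (s := s) (c := c)
  have hA (n : ℕ) : ABG F k s c ^ (n + 1) =
      ABG F k s c ^ n * (Al F k s c * (Be F k s c * Ga F k s c)) := by
    rw [pow_succ, ABG, mul_assoc]
  have hB (n : ℕ) : BGA F k s c ^ (n + 1) =
      BGA F k s c ^ n * (Be F k s c * (Ga F k s c * Al F k s c)) := by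
    rw [pow_succ, BGA, mul_assoc]
  have hG (n : ℕ) : GAB F k s c ^ (n + 1) =
      GAB F k s c ^ n * (Ga F k s c * (Al F k s c * Be F k s c)) := by
    rw [pow_succ, GAB, mul_assoc]
  have mA (n : ℕ) : ABG F k s c ^ n * (Al F k s c * (Be F k s c * Ga F k s c)) ∈
      monoSpan (F := F) (k := k) (s := s) (c := c) := by
    rw [← hA, ← E1_mul_ABG_pow n.succ_pos]
    exact m .a0 (n + 1)
  have mE (n : ℕ) : Et F k s c ^ n * Et F k s c ∈
      monoSpan (F := F) (k := k) (s := s) (c := c) := by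
    rw [← pow_succ, ← E2_mul_Et_pow n.succ_pos]
    exact m .h (n + 1)
  have mz (n : ℕ) : ABG F k s c ^ n * ABG F k s c ^ k ∈
      monoSpan (F := F) (k := k) (s := s) (c := c) := by
    rw [← pow_add, ← E1_mul_ABG_pow (by omega)]
    exact m .a0 (n + k)
  have mB := m .b0 n
  have mB1 := m .b1 (n + 1)
  have mG := m .g0 n
  have mG1 := m .g1 (n + 1)
  simp only [mono, hB, hG, mul_assoc] at mB mB1 mG mG1
  have mE1 := m .a0 0
  have mE2 := m .h 0
  have mAl := m .a1 0
  have mBe := m .b1 0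
  have mGa := m .g1 0
  have mEt := mE 0
  simp only [mono, pow_zero, mul_one, one_mul] at mE1 mE2 mAl mBe mGa mEt
  cases κ
  case a0 =>
    rcases n with _ | n
    · cases t <;> simp [mono, arrow, *]
    · rw [mono, E1_mul_ABG_pow n.succ_pos, hA]
      cases t <;> simp [arrow, mul_assoc, mA]
      simpa only [mono, hA, mul_assoc] using m .a1 (n + 1)
  case h =>
    rcases n with _ | n
    · cases t <;> simp [mono, arrow, *]
    · rw [mono, E2_mul_Et_pow n.succ_pos]
      cases t <;> simp [arrow, mul_assoc, pow_succ]
      · simpa [mul_assoc, pow_succ] using mE n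
      · simpa [mul_assoc, pow_succ] using mE (n + 1)
  all_goals
    cases t <;>
    simp [mono, arrow, hB, hG, mul_assoc, Al_mul_Al, Ga_mul_ABG_pow hk]
  all_goals
    first
    | exact m .a1 n
    | exact m .a2 n
    | exact m .b1 n
    | exact m .b2 n
    | exact m .g1 n
    | exact m .g2 n
    | exact mA n
    | exact Submodule.smul_mem _ _ (mz n)
    | assumption

lemma mono_mul_mem (hk : 1 ≤ k) {x : DA F k s c} (hx : x ∈ monoSpan) (w : FreeAlgebra F Gen) :
    x * mk F k s c w ∈ monoSpan := by
  induction w using FreeAlgebra.induction generalizing x with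
  | grade0 r =>
    rw [AlgHom.commutes, ← Algebra.commutes, ← Algebra.smul_def]
    exact Submodule.smul_mem _ _ hx
  | grade1 t =>
    change x * mk F k s c (gen F t) ∈ _
    rw [mk_gen]
    induction hx using Submodule.span_induction with
    | mem x hx => obtain ⟨i, rfl⟩ := hx; exact mono_mul_arrow_mem hk _ _ _
    | zero => rw [zero_mul]; exact zero_mem _
    | add x y _ _ hx hy => rw [add_mul]; exact add_mem hx hy
    | smul r x _ hx => rw [smul_mul_assoc]; exact Submodule.smul_mem _ _ hx
  | mul a b ha hb => rw [map_mul, ← mul_assoc]; exact hb (ha hx)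
  | add a b ha hb => rw [map_add, mul_add]; exact add_mem (ha hx) (hb hx)

lemma monoSpan_eq_top (hk : 1 ≤ k) : monoSpan (F := F) (k := k) (s := s) (c := c) = ⊤ := by
  refine eq_top_iff.2 fun x _ => ?_
  obtain ⟨w, rfl⟩ := mk_surjective F k s c x
  rw [← one_mul (mk F k s c w), ← E1_add_E2]
  refine mono_mul_mem hk (add_mem ?_ ?_) w
  · simpa [mono] using mono_mem (F := F) (k := k) (s := s) (c := c) .a0 0
  · simpa [mono] using mono_mem (F := F) (k := k) (s := s) (c := c) .h 0

end Monomials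

/-! ### A basis adapted to the commutator subspace -/

section Basis

open Polynomial Matrix

/-- A basis of `DA F k s c` for `Kind.lo κ ≤ n < Kind.hi k s κ`, containing `KK F k s c`. -/
def vec : Kind → ℕ → DA F k s c
  | .a0, 0 => E1 F k s c
  | .a0, n + 1 => ABG F k s c ^ (n + 1) + GAB F k s c ^ (n + 1)
  | .a1, n => ABG F k s c ^ n * Al F k s c
  | .a2, n => ABG F k s c ^ n * (Al F k s c * Be F k s c)
  | .b0, n => ABG F k s c ^ n + BGA F k s c ^ n
  | .b1, n => BGA F k s c ^ n * Be F k s c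
  | .b2, n => BGA F k s c ^ n * (Be F k s c * Ga F k s c)
  | .g0, n => GAB F k s c ^ n
  | .g1, n => GAB F k s c ^ n * Ga F k s c
  | .g2, n => GAB F k s c ^ n * (Ga F k s c * Al F k s c)
  | .h, 0 => E2 F k s c
  | .h, n + 1 => Et F k s c ^ (n + 1)

def Kind.lo : Kind → ℕ
  | .b0 | .g0 => 1
  | _ => 0

def Kind.hi : Kind → ℕ
  | .a0 => k + 1
  | .h => s + 1
  | _ => k

/-- The lower bound for the exponents occurring in `KK`. -/
def Kind.loK : Kind → ℕ
  | .a0 | .a1 | .b0 => 1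
  | .g0 => k
  | .h => s + 1
  | _ => 0

def idx : Finset (Σ _ : Kind, ℕ) := Finset.univ.sigma fun κ => Finset.Ico κ.lo (κ.hi k s)

def idxK : Finset (Σ _ : Kind, ℕ) := Finset.univ.sigma fun κ => Finset.Ico (κ.loK k s) (κ.hi k s)

variable {k s} in
lemma mem_idx {i : Σ _ : Kind, ℕ} : i ∈ idx k s ↔ i.1.lo ≤ i.2 ∧ i.2 < i.1.hi k s := by
  simp [idx]

variable {k s} in
lemma mem_idxK {i : Σ _ : Kind, ℕ} : i ∈ idxK k s ↔ i.1.loK k s ≤ i.2 ∧ i.2 < i.1.hi k s := by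
  simp [idxK]

lemma idxK_subset : idxK k s ⊆ idx k s := by
  rintro ⟨κ, n⟩ h
  rw [mem_idxK] at h
  rw [mem_idx]
  cases κ <;> simp [Kind.lo, Kind.loK, Kind.hi] at * <;> omega

variable {k} in
lemma card_idxK (hk : 1 ≤ k) : (idxK k s).card = 8 * k - 2 := by
  have : (Finset.univ : Finset Kind) = {.a0, .a1, .a2, .b0, .b1, .b2, .g0, .g1, .g2, .h} := rfl
  rw [idxK, Finset.card_sigma, this]
  simp [Kind.loK, Kind.hi]
  omega

def vecAt (i : Σ _ : Kind, ℕ) : DA F k s c := vec F k s c i.1 i.2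

variable {F k s c}

lemma KK_eq (hk : 1 ≤ k) : KK F k s c = vecAt F k s c '' (idxK k s : Set (Σ _ : Kind, ℕ)) := by
  ext x
  constructor
  · have m (κ : Kind) (n : ℕ) (h : κ.loK k s ≤ n) (h' : n < κ.hi k s) :
        vec F k s c κ n ∈ vecAt F k s c '' (idxK k s : Set (Σ _ : Kind, ℕ)) :=
      ⟨⟨κ, n⟩, mem_idxK.2 ⟨h, h'⟩, rfl⟩
    have z (κ : Kind) (h : κ.loK k s = 0) (h' : κ.hi k s = k) := m κ 0 h.le (by rw [h']; exact hk)
    rintro ((((((rfl | rfl) | ⟨n, ⟨hn, hn'⟩, rfl⟩) | ⟨n, ⟨hn, hn'⟩, rfl⟩) |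
      (((rfl | rfl) | ⟨n, ⟨hn, hn'⟩, rfl⟩) | ⟨n, ⟨hn, hn'⟩, rfl⟩)) |
      (((rfl | ⟨n, ⟨hn, hn'⟩, rfl⟩) | ⟨n, ⟨hn, hn'⟩, rfl⟩) | ⟨n, ⟨hn, hn'⟩, rfl⟩)) |
      ⟨n, ⟨hn, hn'⟩, rfl⟩)
    · simpa [vec] using z .b1 rfl rfl
    · simpa [vec] using z .a2 rfl rfl
    · exact m .b1 n n.zero_le (Nat.lt_of_le_pred hk hn')
    · exact m .a2 n n.zero_le (Nat.lt_of_le_pred hk hn')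
    · simpa [vec] using z .g1 rfl rfl
    · simpa [vec] using z .g2 rfl rfl
    · exact m .g1 n n.zero_le (Nat.lt_of_le_pred hk hn')
    · exact m .g2 n n.zero_le (Nat.lt_of_le_pred hk hn')
    · simpa [vec] using z .b2 rfl rfl
    · exact m .b0 n hn (Nat.lt_of_le_pred hk hn')
    · exact m .a1 n hn (Nat.lt_of_le_pred hk hn')
    · exact m .b2 n n.zero_le (Nat.lt_of_le_pred hk hn')
    · obtain ⟨n, rfl⟩ := Nat.exists_eq_add_of_le' hn
      exact m .a0 (n + 1) hn (Nat.lt_succ_of_le hn')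
  · rintro ⟨⟨κ, n⟩, hi, rfl⟩
    obtain ⟨h, h'⟩ := mem_idxK.1 hi
    have p (hn : 1 ≤ n) (h' : n < k) : n ∈ Set.Icc 1 (k - 1) := ⟨hn, Nat.le_pred_of_lt h'⟩
    cases κ
    case a0 =>
      rcases n with _ | n
      · exact absurd h (by simp [Kind.loK])
      · exact Or.inr ⟨n + 1, ⟨h, Nat.le_of_lt_succ h'⟩, rfl⟩
    case a1 => exact Or.inl (Or.inr (Or.inl (Or.inr ⟨n, p h h', rfl⟩)))
    case b0 => exact Or.inl (Or.inr (Or.inl (Or.inl (Or.inr ⟨n, p h h', rfl⟩))))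
    case g0 => exact absurd (h.trans_lt h') (lt_irrefl k)
    case h => exact absurd (h.trans_lt h') (lt_irrefl (s + 1))
    all_goals rcases n.eq_zero_or_pos with rfl | hn
    case a2.inl => exact Or.inl (Or.inl (Or.inl (Or.inl (Or.inl (by simp [vecAt, vec])))))
    case b1.inl => exact Or.inl (Or.inl (Or.inl (Or.inl (Or.inl (by simp [vecAt, vec])))))
    case g1.inl => exact Or.inl (Or.inl (Or.inr (Or.inl (Or.inl (by simp [vecAt, vec])))))
    case g2.inl => exact Or.inl (Or.inl (Or.inr (Or.inl (Or.inl (by simp [vecAt, vec])))))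
    case b2.inl => exact Or.inl (Or.inr (Or.inl (Or.inl (Or.inl (by simp [vecAt, vec])))))
    case a2.inr => exact Or.inl (Or.inl (Or.inl (Or.inr ⟨n, p hn h', rfl⟩)))
    case b1.inr => exact Or.inl (Or.inl (Or.inl (Or.inl (Or.inr ⟨n, p hn h', rfl⟩))))
    case g1.inr => exact Or.inl (Or.inl (Or.inr (Or.inl (Or.inr ⟨n, p hn h', rfl⟩))))
    case g2.inr => exact Or.inl (Or.inl (Or.inr (Or.inr ⟨n, p hn h', rfl⟩)))
    case b2.inr => exact Or.inl (Or.inr (Or.inr ⟨n, p hn h', rfl⟩))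

lemma span_vecAt (hk : 1 ≤ k) (hs : 1 ≤ s) :
    Submodule.span F (vecAt F k s c '' (idx k s : Set (Σ _ : Kind, ℕ))) = ⊤ := by
  set W := Submodule.span F (vecAt F k s c '' (idx k s : Set (Σ _ : Kind, ℕ))) with hW
  have hv (κ : Kind) (n : ℕ) (h : κ.lo ≤ n) (h' : n < κ.hi k s) : vec F k s c κ n ∈ W :=
    Submodule.subset_span ⟨⟨κ, n⟩, mem_idx.2 ⟨h, h'⟩, rfl⟩
  have hE (n : ℕ) (hn : 1 ≤ n) : Et F k s c ^ n ∈ W := by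
    rcases lt_or_ge s n with h | h
    · rw [pow_eq_zero_of_le h (Et_pow_succ_eq_zero hk)]; exact zero_mem _
    · obtain ⟨n, rfl⟩ := Nat.exists_eq_add_of_le' hn
      exact hv .h (n + 1) (Nat.zero_le _) (Nat.lt_succ_of_le h)
  have hG (n : ℕ) (hn : 1 ≤ n) : GAB F k s c ^ n ∈ W := by
    rcases lt_trichotomy n k with h | rfl | h
    · exact hv .g0 n hn h
    · rw [← Et_pow_eq_GAB_pow]; exact hE s hs
    · rw [pow_eq_zero_of_le h (GAB_pow_succ_eq_zero hk)]; exact zero_mem _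
  have hA (n : ℕ) (hn : 1 ≤ n) : ABG F k s c ^ n ∈ W := by
    rcases lt_or_ge k n with h | h
    · rw [pow_eq_zero_of_le h (ABG_pow_succ_eq_zero hk)]; exact zero_mem _
    · obtain ⟨n, rfl⟩ := Nat.exists_eq_add_of_le' hn
      refine (W.add_mem_iff_left (hG (n + 1) hn)).1 ?_
      exact hv .a0 (n + 1) (Nat.zero_le _) (Nat.lt_succ_of_le h)
  have hB (n : ℕ) (hn : 1 ≤ n) : BGA F k s c ^ n ∈ W := by
    rcases lt_trichotomy n k with h | rfl | h
    · exact (W.add_mem_iff_right (hA n hn)).1 (hv .b0 n hn h)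
    · rw [← ABG_pow_eq_BGA_pow]; exact hA _ hn
    · rw [pow_eq_zero_of_le h (BGA_pow_succ_eq_zero hk)]; exact zero_mem _
  rw [← top_le_iff, ← monoSpan_eq_top hk, monoSpan, Submodule.span_le]
  rintro _ ⟨⟨κ, n⟩, rfl⟩
  have small (h : n < k) (h1 : κ.lo = 0) (h2 : κ.hi k s = k) : vec F k s c κ n ∈ W :=
    hv κ n (by rw [h1]; exact n.zero_le) (by rw [h2]; exact h)
  have zero {x y : DA F k s c} (h : x ^ k * y = 0) (hn : k ≤ n) : x ^ n * y ∈ W := by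
    rw [pow_mul_eq_zero_of_le h hn]; exact zero_mem _
  cases κ
  case a0 =>
    change E1 F k s c * ABG F k s c ^ n ∈ W
    rcases n with _ | n
    · rw [pow_zero, mul_one]
      exact hv .a0 0 le_rfl k.succ_pos
    · rw [E1_mul_ABG_pow n.succ_pos]
      exact hA (n + 1) n.succ_pos
  case h =>
    change E2 F k s c * Et F k s c ^ n ∈ W
    rcases n with _ | n
    · rw [pow_zero, mul_one]
      exact hv .h 0 le_rfl s.succ_pos
    · rw [E2_mul_Et_pow n.succ_pos]
      exact hE (n + 1) n.succ_pos
  case b0 => exact hB _ n.succ_pos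
  case g0 => exact hG _ n.succ_pos
  all_goals
    refine (lt_or_ge n k).elim (fun h => small h rfl rfl) (zero ?_)
  · exact ABG_pow_mul_Al_eq_zero hk
  · rw [← mul_assoc, ABG_pow_mul_Al_eq_zero hk, zero_mul]
  · exact BGA_pow_mul_Be_eq_zero hk
  · rw [← mul_assoc, BGA_pow_mul_Be_eq_zero hk, zero_mul]
  · exact GAB_pow_mul_Ga_eq_zero hk
  · rw [← mul_assoc, GAB_pow_mul_Ga_eq_zero hk, zero_mul]

variable (F k s c) in
/-- The element `a` of the algebra and the element `r` of the model come from the same word. -/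
def Rep (a : DA F k s c) (r : Model F) : Prop :=
  ∃ w, mk F k s c w = a ∧ toModel F w = r

namespace Rep

variable {a b : DA F k s c} {r t : Model F}

lemma exists_rep (a : DA F k s c) : ∃ r, Rep F k s c a r :=
  let ⟨w, hw⟩ := mk_surjective F k s c a
  ⟨_, w, hw, rfl⟩

lemma mem (h : Rep F k s c a r) : r ∈ modelOrder F := by
  obtain ⟨w, -, rfl⟩ := h
  exact toModel_mem F w

lemma mul (h : Rep F k s c a r) (h' : Rep F k s c b t) : Rep F k s c (a * b) (r * t) := by
  obtain ⟨w, rfl, rfl⟩ := h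
  obtain ⟨w', rfl, rfl⟩ := h'
  exact ⟨w * w', map_mul .., map_mul ..⟩

lemma add (h : Rep F k s c a r) (h' : Rep F k s c b t) : Rep F k s c (a + b) (r + t) := by
  obtain ⟨w, rfl, rfl⟩ := h
  obtain ⟨w', rfl, rfl⟩ := h'
  exact ⟨w + w', map_add .., map_add ..⟩

lemma sub (h : Rep F k s c a r) (h' : Rep F k s c b t) : Rep F k s c (a - b) (r - t) := by
  obtain ⟨w, rfl, rfl⟩ := h
  obtain ⟨w', rfl, rfl⟩ := h'
  exact ⟨w - w', map_sub .., map_sub ..⟩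

lemma smul (x : F) (h : Rep F k s c a r) : Rep F k s c (x • a) (x • r) := by
  obtain ⟨w, rfl, rfl⟩ := h
  exact ⟨x • w, map_smul .., map_smul ..⟩

lemma pow (n : ℕ) (h : Rep F k s c a r) : Rep F k s c (a ^ n) (r ^ n) := by
  obtain ⟨w, rfl, rfl⟩ := h
  exact ⟨w ^ n, map_pow .., map_pow ..⟩

lemma one : Rep F k s c 1 1 := ⟨1, map_one _, map_one _⟩

lemma arrow (t : Gen) : Rep F k s c (arrow F k s c t) (modelGen F t) :=
  ⟨gen F t, mk_gen t, toModel_gen F t⟩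

lemma ABG_pow {n : ℕ} (hn : 1 ≤ n) : Rep F k s c (ABG F k s c ^ n) (single 0 0 (X ^ n), 0, 0) := by
  rw [← modelGen_pow_ABG hn]
  exact (((arrow .a).mul (arrow .b)).mul (arrow .g)).pow n

lemma BGA_pow {n : ℕ} (hn : 1 ≤ n) : Rep F k s c (BGA F k s c ^ n) (single 1 1 (X ^ n), 0, 0) := by
  rw [← modelGen_pow_BGA hn]
  exact (((arrow .b).mul (arrow .g)).mul (arrow .a)).pow n

lemma GAB_pow {n : ℕ} (hn : 1 ≤ n) : Rep F k s c (GAB F k s c ^ n) (single 2 2 (X ^ n), 0, 0) := by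
  rw [← modelGen_pow_GAB hn]
  exact (((arrow .g).mul (arrow .a)).mul (arrow .b)).pow n

lemma Et_pow {n : ℕ} (hn : 1 ≤ n) : Rep F k s c (Et F k s c ^ n) (0, X ^ n, 0) := by
  rw [← modelGen_pow_h hn]
  exact (arrow .h).pow n

end Rep

variable (F) in
def vecModel : Kind → ℕ → Model F
  | .a0, 0 => modelGen F .e1
  | .a0, n + 1 => (single 0 0 (X ^ (n + 1)) + single 2 2 (X ^ (n + 1)), 0, 0)
  | .a1, n => (single 0 1 (X ^ n), 0, if n = 0 then X else 0)
  | .a2, n => (single 0 2 (X ^ n), 0, 0)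
  | .b0, n => (single 0 0 (X ^ n) + single 1 1 (X ^ n), 0, 0)
  | .b1, n => (single 1 2 (X ^ n), 0, 0)
  | .b2, n => (single 1 0 (X ^ (n + 1)), 0, 0)
  | .g0, n => (single 2 2 (X ^ n), 0, 0)
  | .g1, n => (single 2 0 (X ^ (n + 1)), 0, 0)
  | .g2, n => (single 2 1 (X ^ (n + 1)), 0, 0)
  | .h, 0 => modelGen F .e2
  | .h, n + 1 => (0, X ^ (n + 1), 0)

lemma rep_vec (κ : Kind) {n : ℕ} (hn : κ.lo ≤ n) :
    Rep F k s c (vec F k s c κ n) (vecModel F κ n) := by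
  have hA (n : ℕ) := Rep.ABG_pow (F := F) (k := k) (s := s) (c := c) n.succ_pos
  have hB (n : ℕ) := Rep.BGA_pow (F := F) (k := k) (s := s) (c := c) n.succ_pos
  have hG (n : ℕ) := Rep.GAB_pow (F := F) (k := k) (s := s) (c := c) n.succ_pos
  have hE (n : ℕ) := Rep.Et_pow (F := F) (k := k) (s := s) (c := c) n.succ_pos
  have ha := Rep.arrow (F := F) (k := k) (s := s) (c := c) .a
  have hb := Rep.arrow (F := F) (k := k) (s := s) (c := c) .b
  have hg := Rep.arrow (F := F) (k := k) (s := s) (c := c) .g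
  have hab := ha.mul hb
  have hbg := hb.mul hg
  have hga := hg.mul ha
  rcases n with _ | n
  · cases κ
    case a0 => exact Rep.arrow .e1
    case h => exact Rep.arrow .e2
    all_goals simp [Kind.lo] at hn
    all_goals simp only [vec, vecModel, pow_zero, one_mul]
    · exact ha
    · simpa [modelGen] using! hab
    · exact hb
    · simpa [modelGen] using! hbg
    · simpa [modelGen] using! hg
    · simpa [modelGen] using! hga
  · cases κ
    · simpa [vec, vecModel] using (hA n).add (hG n)
    · simpa [vec, vecModel, modelGen] using! (hA n).mul ha
    · simpa [vec, vecModel, modelGen] using! (hA n).mul hab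
    · simpa [vec, vecModel] using (hA n).add (hB n)
    · simpa [vec, vecModel, modelGen] using! (hB n).mul hb
    · simpa [vec, vecModel, modelGen, pow_succ] using! (hB n).mul hbg
    · simpa [vec, vecModel] using hG n
    · simpa [vec, vecModel, modelGen, pow_succ] using! (hG n).mul hg
    · simpa [vec, vecModel, modelGen, pow_succ] using! (hG n).mul hga
    · simpa [vec, vecModel] using hE n

end Basis


/-! ### Dual basis and the commutator subspace -/

section Dual

open Polynomial Matrix

variable {F}

/-- The coordinate functions of the basis `vec`, on the model. -/
def coef : Kind → ℕ → Model F → F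
  | .a0, n, r => if n = 0 then (r.1 0 0).coeff 0 else
      (r.1 0 0).coeff n + (r.1 1 1).coeff n + if n = k then c * r.2.2.coeff 2 else 0
  | .a1, n, r => (r.1 0 1).coeff n
  | .a2, n, r => (r.1 0 2).coeff n
  | .b0, n, r => (r.1 1 1).coeff n
  | .b1, n, r => (r.1 1 2).coeff n
  | .b2, n, r => (r.1 1 0).coeff (n + 1)
  | .g0, n, r => r.1.trace.coeff n
  | .g1, n, r => (r.1 2 0).coeff (n + 1)
  | .g2, n, r => (r.1 2 1).coeff (n + 1)
  | .h, n, r => if n = s then modelTrace F k s c r else r.2.1.coeff n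

variable {k s c}

lemma exists_dual (hk : 1 ≤ k) {κ : Kind} {n : ℕ} (h : κ.lo ≤ n) (h' : n < κ.hi k s) :
    ∃ d δ, Rep F k s c d δ ∧
      ∀ r ∈ modelOrder F, modelTrace F k s c (r * δ) = coef k s c κ n r := by
  cases κ
  case a0 =>
    rcases n.eq_zero_or_pos with rfl | hn
    · refine ⟨_, _, Rep.ABG_pow hk, fun r hr => ?_⟩
      simp [modelTrace_apply, coef, trace_mul_single, coeff_mul_X_pow']
    · rcases (Nat.le_of_lt_succ h').lt_or_eq with hnk | rfl
      · refine ⟨_, _, (Rep.ABG_pow (n := k - n) (by omega)).add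
          (Rep.BGA_pow (n := k - n) (by omega)), fun r hr => ?_⟩
        have : k - (k - n) = n := by omega
        simp [modelTrace_apply, coef, mul_add, trace_mul_single, coeff_mul_X_pow', this, hnk.ne,
          hn.ne']
      · refine ⟨_, _, Rep.arrow .e1, fun r hr => ?_⟩
        simp [modelTrace_apply, modelGen, coef, mul_add, trace_mul_single, hn.ne']
  case a1 =>
    have h' : n < k := h'
    refine ⟨_, _, rep_vec .b2 (n := k - 1 - n) (Nat.zero_le _), fun r hr => ?_⟩
    have h1 : k - 1 - n + 1 ≤ k := by omega
    have h2 : k - (k - 1 - n + 1) = n := by omega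
    simp [modelTrace_apply, vecModel, coef, trace_mul_single, coeff_mul_X_pow', h1, h2]
  case a2 =>
    have h' : n < k := h'
    refine ⟨_, _, rep_vec .g1 (n := k - 1 - n) (Nat.zero_le _), fun r hr => ?_⟩
    have h1 : k - 1 - n + 1 ≤ k := by omega
    have h2 : k - (k - 1 - n + 1) = n := by omega
    simp [modelTrace_apply, vecModel, coef, trace_mul_single, coeff_mul_X_pow', h1, h2]
  case b1 =>
    have h' : n < k := h'
    refine ⟨_, _, rep_vec .g2 (n := k - 1 - n) (Nat.zero_le _), fun r hr => ?_⟩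
    have h1 : k - 1 - n + 1 ≤ k := by omega
    have h2 : k - (k - 1 - n + 1) = n := by omega
    simp [modelTrace_apply, vecModel, coef, trace_mul_single, coeff_mul_X_pow', h1, h2]
  case b0 =>
    have h' : n < k := h'
    refine ⟨_, _, Rep.BGA_pow (n := k - n) (by omega), fun r hr => ?_⟩
    have : k - (k - n) = n := by omega
    simp [modelTrace_apply, coef, trace_mul_single, coeff_mul_X_pow', this]
  case g0 =>
    have h' : n < k := h'
    refine ⟨_, _, ((Rep.ABG_pow (n := k - n) (by omega)).add
      (Rep.BGA_pow (n := k - n) (by omega))).add (Rep.GAB_pow (n := k - n) (by omega)),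
      fun r hr => ?_⟩
    have : k - (k - n) = n := by omega
    simp [modelTrace_apply, coef, mul_add, trace_mul_single, coeff_mul_X_pow', this,
      trace_fin_three r.1]
  case g1 =>
    have h' : n < k := h'
    refine ⟨_, _, rep_vec .a2 (n := k - 1 - n) (Nat.zero_le _), fun r hr => ?_⟩
    have h1 : k - 1 - n ≤ k := by omega
    have h2 : k - (k - 1 - n) = n + 1 := by omega
    simp [modelTrace_apply, vecModel, coef, trace_mul_single, coeff_mul_X_pow', h1, h2]
  case g2 =>
    have h' : n < k := h'
    refine ⟨_, _, rep_vec .b1 (n := k - 1 - n) (Nat.zero_le _), fun r hr => ?_⟩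
    have h1 : k - 1 - n ≤ k := by omega
    have h2 : k - (k - 1 - n) = n + 1 := by omega
    simp [modelTrace_apply, vecModel, coef, trace_mul_single, coeff_mul_X_pow', h1, h2]
  case b2 =>
    have h' : n < k := h'
    have h1 : k - 1 - n ≤ k := by omega
    have h2 : k - (k - 1 - n) = n + 1 := by omega
    refine ⟨_, _, (rep_vec .a1 (n := k - 1 - n) (Nat.zero_le _)).sub
      ((rep_vec .b2 (n := k - 1) (Nat.zero_le _)).smul (if k - 1 - n = 0 then c else 0)),
      fun r hr => ?_⟩
    obtain ⟨-, -, -, -, -, h6, -⟩ := mem_modelOrder.1 hr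
    rw [mul_sub, mul_smul_comm, map_sub, map_smul]
    split_ifs with h3
    · have h4 : k = n + 1 := by omega
      simp [modelTrace_apply, vecModel, coef, trace_mul_single, coeff_mul_X_pow', h6, h4]
    · simp [modelTrace_apply, vecModel, coef, trace_mul_single, coeff_mul_X_pow', h1, h2, h3]
  case h =>
    rcases (Nat.le_of_lt_succ h').lt_or_eq with hn | rfl
    · refine ⟨_, _, Rep.Et_pow (n := s - n) (by omega), fun r hr => ?_⟩
      have : s - (s - n) = n := by omega
      simp [modelTrace_apply, coef, coeff_mul_X_pow', this, hn.ne]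
    · exact ⟨1, 1, Rep.one, fun r hr => by simp [coef]⟩

lemma coef_vecModel [CharP F 2] (hk : 1 ≤ k) (hs : 1 ≤ s) {i j : Σ _ : Kind, ℕ}
    (hi : i ∈ idx k s) (hj : j ∈ idx k s) :
    coef k s c j.1 j.2 (vecModel F i.1 i.2) = if i = j then 1 else 0 := by
  obtain ⟨κ, n⟩ := i
  obtain ⟨κ', m⟩ := j
  rw [mem_idx] at hi hj
  cases κ <;> cases κ' <;> rcases n with _ | n <;>
    simp [Kind.lo, Kind.hi] at hi hj <;>
    simp [coef, vecModel, modelGen, modelTrace_apply, coeff_X_pow, coeff_one,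
      CharTwo.add_self_eq_zero]
  all_goals grind [coeff_X]

lemma coef_mul_comm {i : Σ _ : Kind, ℕ} (hi : i ∈ idx k s) (hi' : i ∉ idxK k s) {r t : Model F}
    (hr : r ∈ modelOrder F) (ht : t ∈ modelOrder F) :
    coef k s c i.1 i.2 (r * t) = coef k s c i.1 i.2 (t * r) := by
  obtain ⟨κ, n⟩ := i
  rw [mem_idx] at hi
  rw [mem_idxK] at hi'
  obtain ⟨h1, h2, h3, h4, -, -, -⟩ := hr
  obtain ⟨h1', h2', h3', h4', -, -, -⟩ := ht
  cases κ
  case h =>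
    simp only [coef]
    split_ifs
    · exact modelTrace_mul_comm ..
    · simp [mul_comm r.2.1]
  case g0 => simp [coef, trace_mul_comm r.1]
  case a0 =>
    obtain rfl : n = 0 := by simp [Kind.loK, Kind.lo, Kind.hi] at *; omega
    simp [coef, mul_apply, Fin.sum_univ_three, *]
    ring
  case a1 =>
    obtain rfl : n = 0 := by simp [Kind.loK, Kind.lo, Kind.hi] at *; omega
    simp [coef, mul_apply, Fin.sum_univ_three, *]
    ring
  all_goals exact absurd hi hi'

end Dual

section Commutators

variable {F k s c}

lemma exists_dual_family [CharP F 2] (hk : 1 ≤ k) (hs : 1 ≤ s) :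
    ∃ (ψ : DA F k s c →ₗ[F] F) (d : (Σ _ : Kind, ℕ) → DA F k s c),
      (∀ a b, ψ (a * b) = ψ (b * a)) ∧
      (∀ i ∈ idx k s, ∀ j ∈ idx k s, ψ (vecAt F k s c i * d j) = if i = j then 1 else 0) ∧
      ∀ i ∈ idx k s, i ∉ idxK k s → ∀ a b, ψ (a * b * d i) = ψ (b * a * d i) := by
  obtain ⟨ψ, hψ⟩ := exists_trace F k s c hk hs
  have hrep {a r} (h : Rep F k s c a r) : ψ a = modelTrace F k s c r := by
    obtain ⟨w, rfl, rfl⟩ := h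
    exact hψ w
  have hdual (i : Σ _ : Kind, ℕ) : ∃ d, i ∈ idx k s →
      ∀ a r, Rep F k s c a r → ψ (a * d) = coef k s c i.1 i.2 r := by
    by_cases hi : i ∈ idx k s
    · obtain ⟨d, δ, h, h'⟩ := exists_dual (F := F) (c := c) hk (mem_idx.1 hi).1 (mem_idx.1 hi).2
      exact ⟨d, fun _ a r ha => by rw [hrep (ha.mul h), h' r ha.mem]⟩
    · exact ⟨0, fun h => absurd h hi⟩
  choose d hd using hdual
  refine ⟨ψ, d, fun a b => ?_, fun i hi j hj => ?_, fun i hi hi' a b => ?_⟩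
  · obtain ⟨r, hr⟩ := Rep.exists_rep a
    obtain ⟨t, ht⟩ := Rep.exists_rep b
    rw [hrep (hr.mul ht), hrep (ht.mul hr), modelTrace_mul_comm]
  · rw [vecAt, hd j hj _ _ (rep_vec i.1 (mem_idx.1 hi).1), coef_vecModel hk hs hi hj]
  · obtain ⟨r, hr⟩ := Rep.exists_rep a
    obtain ⟨t, ht⟩ := Rep.exists_rep b
    rw [hd i hi _ _ (hr.mul ht), hd i hi _ _ (ht.mul hr), coef_mul_comm hi hi' hr.mem ht.mem]

lemma eq_sum_vecAt (hk : 1 ≤ k) (hs : 1 ≤ s) {ψ : DA F k s c →ₗ[F] F}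
    {d : (Σ _ : Kind, ℕ) → DA F k s c}
    (hd : ∀ i ∈ idx k s, ∀ j ∈ idx k s, ψ (vecAt F k s c i * d j) = if i = j then 1 else 0)
    (x : DA F k s c) : x = ∑ i ∈ idx k s, ψ (x * d i) • vecAt F k s c i := by
  have hx : x ∈ Submodule.span F (vecAt F k s c '' (idx k s : Set (Σ _ : Kind, ℕ))) := by
    rw [span_vecAt hk hs]; trivial
  induction hx using Submodule.span_induction with
  | mem x hx =>
    obtain ⟨i, hi, rfl⟩ := hx
    rw [Finset.sum_congr rfl fun j hj => by rw [hd i hi j hj]]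
    simp only [ite_smul, one_smul, zero_smul, Finset.sum_ite_eq, Finset.mem_coe.1 hi, if_true]
  | zero => simp
  | add x y _ _ hx hy =>
    simp only [add_mul, map_add, add_smul, Finset.sum_add_distrib]
    rw [← hx, ← hy]
  | smul r x _ hx =>
    simp only [smul_mul_assoc, map_smul, smul_assoc, ← Finset.smul_sum]
    rw [← hx]

lemma linearIndepOn_vecAt {ψ : DA F k s c →ₗ[F] F} {d : (Σ _ : Kind, ℕ) → DA F k s c}
    (hd : ∀ i ∈ idx k s, ∀ j ∈ idx k s, ψ (vecAt F k s c i * d j) = if i = j then 1 else 0) :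
    LinearIndepOn F (vecAt F k s c) (idx k s) := by
  refine linearIndepOn_finset_iff.2 fun f hf j hj => ?_
  have h : ψ ((∑ i ∈ idx k s, f i • vecAt F k s c i) * d j) = 0 := by rw [hf, zero_mul, map_zero]
  rw [Finset.sum_mul, map_sum, Finset.sum_congr rfl fun i hi => by
    rw [smul_mul_assoc, map_smul, hd i hi j hj]] at h
  simpa [hj] using h

lemma commutator_mem_Kspan (A : Type) [Ring A] [Algebra F A] (x y : A) :
    x * y - y * x ∈ Kspan F A := Submodule.subset_span ⟨x, y, rfl⟩

lemma add_eq_sub_of_charTwo [CharP F 2] {M : Type} [AddCommGroup M] [Module F M] (x y : M) :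
    x + y = x - y := by
  have h : y + y = 0 := by rw [← two_smul F, CharTwo.two_eq_zero, zero_smul]
  rw [sub_eq_add_neg, neg_eq_of_add_eq_zero_left h]

lemma vecAt_mem_Kspan [CharP F 2] (hk : 1 ≤ k) {i : Σ _ : Kind, ℕ} (hi : i ∈ idxK k s) :
    vecAt F k s c i ∈ Kspan F (DA F k s c) := by
  obtain ⟨κ, n⟩ := i
  obtain ⟨h, h'⟩ := mem_idxK.1 hi
  have key {x : DA F k s c} (u v : DA F k s c) (hx : x = u * v - v * u) :
      x ∈ Kspan F (DA F k s c) := hx ▸ commutator_mem_Kspan _ u v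
  cases κ
  case g0 => exact absurd (h.trans_lt h') (lt_irrefl k)
  case h => exact absurd (h.trans_lt h') (lt_irrefl (s + 1))
  case a0 =>
    rcases n with _ | n
    · exact absurd h (by simp [Kind.loK])
    refine key (ABG F k s c ^ n * (Al F k s c * Be F k s c)) (Ga F k s c) ?_
    rw [vecAt, vec, add_eq_sub_of_charTwo (F := F), ← mul_assoc (Ga F k s c), ← GAB_pow_mul_Ga,
      pow_succ, pow_succ, ABG, GAB]
    simp only [mul_assoc]
  case a1 =>
    refine key (ABG F k s c ^ n) (Al F k s c) ?_
    rw [Al_mul_ABG_pow hk h, sub_zero]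
    rfl
  case b0 =>
    obtain ⟨n, rfl⟩ := Nat.exists_eq_add_of_le' (show 1 ≤ n from h)
    refine key (Al F k s c) (Be F k s c * Ga F k s c * ABG F k s c ^ n) ?_
    rw [vecAt, vec, add_eq_sub_of_charTwo (F := F), mul_assoc _ _ (Al F k s c), ABG_pow_mul_Al,
      pow_succ', pow_succ']
    nth_rw 1 [ABG]
    nth_rw 1 [BGA]
    simp only [mul_assoc]
  case a2 =>
    refine key (ABG F k s c ^ n * (Al F k s c * Be F k s c)) (E2 F k s c) ?_
    have h1 : ABG F k s c ^ n * (Al F k s c * Be F k s c) * E2 F k s c =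
        ABG F k s c ^ n * (Al F k s c * Be F k s c) := by simp [mul_assoc]
    have h2 : E2 F k s c * (ABG F k s c ^ n * (Al F k s c * Be F k s c)) = 0 := by
      rw [ABG_pow_mul_AlBe]
      simp [← mul_assoc]
    rw [h1, h2, sub_zero]
    rfl
  case b1 =>
    refine key (BGA F k s c ^ n * Be F k s c) (E2 F k s c) ?_
    have h1 : BGA F k s c ^ n * Be F k s c * E2 F k s c =
        BGA F k s c ^ n * Be F k s c := by simp [mul_assoc]
    have h2 : E2 F k s c * (BGA F k s c ^ n * Be F k s c) = 0 := by
      rw [BGA_pow_mul_Be]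
      simp [← mul_assoc]
    rw [h1, h2, sub_zero]
    rfl
  case g1 =>
    refine key (GAB F k s c ^ n * Ga F k s c) (E1 F k s c) ?_
    have h1 : GAB F k s c ^ n * Ga F k s c * E1 F k s c =
        GAB F k s c ^ n * Ga F k s c := by simp [mul_assoc]
    have h2 : E1 F k s c * (GAB F k s c ^ n * Ga F k s c) = 0 := by
      rw [GAB_pow_mul_Ga]
      simp [← mul_assoc]
    rw [h1, h2, sub_zero]
    rfl
  case g2 =>
    refine key (GAB F k s c ^ n * (Ga F k s c * Al F k s c)) (E1 F k s c) ?_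
    have h1 : GAB F k s c ^ n * (Ga F k s c * Al F k s c) * E1 F k s c =
        GAB F k s c ^ n * (Ga F k s c * Al F k s c) := by simp [mul_assoc]
    have h2 : E1 F k s c * (GAB F k s c ^ n * (Ga F k s c * Al F k s c)) = 0 := by
      rw [GAB_pow_mul_GaAl]
      simp [← mul_assoc]
    rw [h1, h2, sub_zero]
    rfl
  case b2 =>
    refine key (BGA F k s c ^ n * Be F k s c) (Ga F k s c) ?_
    have h2 : Ga F k s c * (BGA F k s c ^ n * Be F k s c) = 0 := by
      rw [BGA_pow_mul_Be, ← mul_assoc, Ga_mul_Be, zero_mul]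
    rw [h2, sub_zero, mul_assoc]
    rfl

lemma span_KK [CharP F 2] (hk : 1 ≤ k) (hs : 1 ≤ s) :
    Submodule.span F (KK F k s c) = Kspan F (DA F k s c) := by
  rw [KK_eq hk]
  obtain ⟨ψ, d, -, hd, hd'⟩ := exists_dual_family (F := F) (c := c) hk hs
  apply le_antisymm
  · rw [Submodule.span_le]
    rintro _ ⟨i, hi, rfl⟩
    exact vecAt_mem_Kspan hk hi
  · refine Submodule.span_le.2 ?_
    rintro _ ⟨u, v, rfl⟩
    rw [SetLike.mem_coe, eq_sum_vecAt hk hs hd (u * v - v * u)]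
    refine Submodule.sum_mem _ fun i hi => ?_
    by_cases hi' : i ∈ idxK k s
    · exact Submodule.smul_mem _ _ (Submodule.subset_span ⟨i, hi', rfl⟩)
    · rw [sub_mul, map_sub, hd' i hi hi', sub_self, zero_smul]
      exact zero_mem _

lemma linearIndepOn_vecAt_idxK [CharP F 2] (hk : 1 ≤ k) (hs : 1 ≤ s) :
    LinearIndepOn F (vecAt F k s c) (idxK k s) :=
  let ⟨_, _, _, hd, _⟩ := exists_dual_family (F := F) (c := c) hk hs
  (linearIndepOn_vecAt hd).mono (Finset.coe_subset.2 (idxK_subset k s))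

lemma linearIndepOn_KK [CharP F 2] (hk : 1 ≤ k) (hs : 1 ≤ s) :
    LinearIndepOn F id (KK F k s c) := by
  rw [KK_eq hk]
  exact (linearIndepOn_vecAt_idxK hk hs).id_image

lemma finrank_Kspan [CharP F 2] (hk : 1 ≤ k) (hs : 1 ≤ s) :
    Module.finrank F (Kspan F (DA F k s c)) = 8 * k - 2 := by
  rw [← span_KK hk hs, KK_eq hk, Set.image_eq_range,
    finrank_span_eq_card (linearIndepOn_vecAt_idxK hk hs)]
  simp [card_idxK s hk]

/-- In a finite-dimensional algebra with a symmetric nondegenerate trace form, the center is the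
orthogonal of the commutator subspace. -/
lemma finrank_center_add_finrank_Kspan (A : Type) [Ring A] [Algebra F A] [FiniteDimensional F A]
    (ψ : A →ₗ[F] F) (hψ : ∀ a b, ψ (a * b) = ψ (b * a)) (hψ' : ∀ a, (∀ b, ψ (a * b) = 0) → a = 0) :
    Module.finrank F (Subalgebra.center F A) + Module.finrank F (Kspan F A) =
      Module.finrank F A := by
  let B : LinearMap.BilinForm F A := (LinearMap.mul F A).compr₂ ψ
  have hB (x y : A) : B x y = ψ (x * y) := rfl
  have hnd : B.Nondegenerate :=
    ⟨hψ', fun y h => hψ' y fun x => (hψ y x).trans (h x)⟩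
  have hcenter : (Subalgebra.center F A).toSubmodule = B.orthogonal (Kspan F A) := by
    ext z
    rw [Subalgebra.mem_toSubmodule, Subalgebra.mem_center_iff,
      LinearMap.BilinForm.mem_orthogonal_iff]
    constructor
    · intro hz y hy
      change B y z = 0
      induction hy using Submodule.span_induction with
      | mem y hy =>
        obtain ⟨u, v, rfl⟩ := hy
        rw [hB, sub_mul, map_sub, mul_assoc v, hz u, ← mul_assoc, hψ (v * z), mul_assoc, sub_self]
      | zero => rw [map_zero, LinearMap.zero_apply]
      | add x y _ _ hx hy => rw [map_add, LinearMap.add_apply, hx, hy, add_zero]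
      | smul r x _ hx => rw [map_smul, LinearMap.smul_apply, hx, smul_zero]
    · intro h u
      refine sub_eq_zero.1 (hψ' _ fun y => ?_)
      have := h _ (commutator_mem_Kspan A y u)
      change ψ ((y * u - u * y) * z) = 0 at this
      rw [sub_mul, map_sub] at this ⊢
      rw [← this, mul_assoc y, hψ y, hψ (u * y), mul_assoc z]
  rw [← Subalgebra.finrank_toSubmodule, hcenter, LinearMap.BilinForm.finrank_orthogonal hnd,
    Nat.sub_add_cancel (Submodule.finrank_le _)]

lemma finrank_sub_finrank_center [CharP F 2] (hk : 1 ≤ k) (hs : 1 ≤ s) :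
    Module.finrank F (DA F k s c) - Module.finrank F (Subalgebra.center F (DA F k s c)) =
      Module.finrank F (Kspan F (DA F k s c)) := by
  obtain ⟨ψ, d, hψ, hd, -⟩ := exists_dual_family (F := F) (c := c) hk hs
  have : FiniteDimensional F (DA F k s c) :=
    ⟨(span_vecAt (F := F) (c := c) hk hs) ▸
      Submodule.fg_span ((idx k s).finite_toSet.image _)⟩
  refine Nat.sub_eq_of_eq_add' (finrank_center_add_finrank_Kspan _ ψ hψ fun a ha => ?_).symm
  rw [eq_sum_vecAt hk hs hd a]
  exact Finset.sum_eq_zero fun i _ => by rw [ha, zero_smul]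

end Commutators

set_option synthInstance.maxHeartbeats 1000000 in
/-- **Basis of the commutator subspace of `A^{k,s}_c` (dihedral type).**
For `k, s ≥ 1` and `c ∈ {0,1}` the set 𝓚 is an F-basis of `K(A^{k,s}_c)`;
in particular `dim_F K(A^{k,s}_c) = 8k - 2 = dim_F A^{k,s}_c - dim_F Z(A^{k,s}_c)`. -/
theorem dihedral_commutator_basis
    (F : Type) [Field F] [IsAlgClosed F] [CharP F 2]
    (k s : ℕ) (hk : 1 ≤ k) (hs : 1 ≤ s) (c : F) (hc : c = 0 ∨ c = 1) :
    LinearIndependent F (fun p : (KK F k s c) => (p : DA F k s c)) ∧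
    Submodule.span F (KK F k s c) = Kspan F (DA F k s c) ∧
    Module.finrank F ↥(Kspan F (DA F k s c)) = 8 * k - 2 ∧
    8 * k - 2
      = Module.finrank F (DA F k s c)
          - Module.finrank F ↥(Subalgebra.center F (DA F k s c)) := by
  rw [← finrank_Kspan (F := F) (s := s) (c := c) hk hs]
  exact ⟨linearIndepOn_KK hk hs, span_KK hk hs, rfl, (finrank_sub_finrank_center hk hs).symm⟩

end DihedralPaper

end
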